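/- Let (S, 𝔫) be a commutative Noetherian local ring and I an 𝔫-primary ideal which is not a power of 𝔫; write R = S/I with maximal ideal 𝔪 = 𝔫/I and v = v_S(I) = max{n | I ⊆ 𝔫^n}. Then the following are equivalent: (1) s(R) = ℓ_S(R) − Σ_{i=0}^{v−1} h_S(i) + v − 1; (2) μ_R(𝔪^v) = 1; (3) the Hilbert function of R satisfies h_R(i) = 1 for all v ≤ i ≤ s(R) and h_R(i) = 0 for all i > s(R). -/

import Mathlib

open IsLocalRing

/-- The length of a module: the Krull dimension of its lattice of submodules. -/
noncomputable def moduleLength (R M : Type*) [Ring R] [AddCommGroup M] [Module R M] :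
    WithBot ℕ∞ :=
  Order.krullDim (Submodule R M)

lemma aux_nak {R : Type*} [CommRing R] [IsNoetherianRing R] [IsLocalRing R] (i : ℕ)
    (h : maximalIdeal R ^ i ≤ maximalIdeal R ^ (i+1)) : maximalIdeal R ^ i = ⊥ := by
  refine Submodule.eq_bot_of_le_smul_of_le_jacobson_bot (maximalIdeal R) _
    (IsNoetherian.noetherian _) ?_ (IsLocalRing.maximalIdeal_le_jacobson _)
  rwa [smul_eq_mul, ← pow_succ']

lemma aux_unit {R : Type*} [CommRing R] [IsLocalRing R] (i : ℕ) (x y : R)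
    (hx : maximalIdeal R ^ i = Ideal.span {x}) (hy : y ∈ maximalIdeal R ^ i)
    (hy' : y ∉ maximalIdeal R ^ (i+1)) : maximalIdeal R ^ i = Ideal.span {y} := by
  have hy2 := hy
  rw [hx, Ideal.mem_span_singleton'] at hy2
  obtain ⟨c, rfl⟩ := hy2
  have hc : IsUnit c := by
    by_contra hc
    apply hy'
    rw [pow_succ']
    exact Ideal.mul_mem_mul ((mem_maximalIdeal c).2 hc) (hx ▸ Ideal.mem_span_singleton_self x)
  rw [hx, Ideal.span_singleton_mul_left_unit hc]

lemma aux_cov {R : Type*} [CommRing R] [IsNoetherianRing R] [IsLocalRing R] (i : ℕ) :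
    ((∃ x, maximalIdeal R ^ i = Ideal.span {x}) ∧ maximalIdeal R ^ i ≠ ⊥) ↔
      maximalIdeal R ^ (i+1) ⋖ maximalIdeal R ^ i := by
  constructor
  · rintro ⟨⟨x, hx⟩, h0⟩
    refine ⟨lt_of_le_not_ge (Ideal.pow_le_pow_right (Nat.le_succ i)) fun h => h0 (aux_nak i h), ?_⟩
    intro K hK hK'
    obtain ⟨y, hy, hy'⟩ := SetLike.exists_of_lt hK
    have := aux_unit i x y hx (hK'.le hy) hy'
    exact hK'.not_ge (this ▸ (Ideal.span_singleton_le_iff_mem _).2 hy)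
  · intro h
    refine ⟨?_, ?_⟩
    · obtain ⟨x, hx, hx'⟩ := SetLike.exists_of_lt h.lt
      refine ⟨x, le_antisymm ?_ ((Ideal.span_singleton_le_iff_mem _).2 hx)⟩
      refine Submodule.le_of_le_smul_of_le_jacobson_bot (I := maximalIdeal R)
        (IsNoetherian.noetherian _) (IsLocalRing.maximalIdeal_le_jacobson _) ?_
      rw [smul_eq_mul, ← pow_succ']
      have h1 : maximalIdeal R ^ (i+1) < Ideal.span {x} ⊔ maximalIdeal R ^ (i+1) := by
        refine lt_of_le_not_ge le_sup_right fun h => hx' (h ?_)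
        exact Ideal.mem_sup_left (Ideal.mem_span_singleton_self x)
      by_contra h2
      refine h.2 h1 (lt_of_le_not_ge (sup_le ((Ideal.span_singleton_le_iff_mem _).2 hx) h.le) h2)
    · intro h0
      exact absurd (h0 ▸ h.lt) not_lt_bot

lemma aux_step {R : Type*} [CommRing R] [IsNoetherianRing R] [IsLocalRing R] (i : ℕ)
    (h : ∃ x, maximalIdeal R ^ (i+1) = Ideal.span {x}) :
    ∃ x, maximalIdeal R ^ (i+2) = Ideal.span {x} := by
  obtain ⟨x, hx⟩ := h
  by_cases H : ∀ a ∈ maximalIdeal R, ∀ b ∈ maximalIdeal R ^ i, a * b ∈ maximalIdeal R ^ (i+2)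
  · have : maximalIdeal R ^ (i+1) ≤ maximalIdeal R ^ (i+2) := by
      conv_lhs => rw [pow_succ']
      exact Ideal.mul_le.2 H
    have h0 := aux_nak (i+1) this
    refine ⟨0, ?_⟩
    rw [pow_succ, h0]; simp
  · push Not at H
    obtain ⟨a, ha, b, hb, hab⟩ := H
    have hab' : a * b ∈ maximalIdeal R ^ (i+1) := by
      rw [pow_succ']; exact Ideal.mul_mem_mul ha hb
    have h1 := aux_unit (i+1) x _ hx hab' hab
    refine ⟨a * x, le_antisymm ?_ ?_⟩
    · rw [pow_succ (n := i+1), h1, Ideal.span_singleton_mul_le_iff]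
      intro z hz
      have : z * b ∈ Ideal.span {x} := by
        rw [← hx, pow_succ']; exact Ideal.mul_mem_mul hz hb
      rw [Ideal.mem_span_singleton'] at this ⊢
      obtain ⟨c, hc⟩ := this
      exact ⟨c, by linear_combination a * hc⟩
    · rw [Ideal.span_singleton_le_iff_mem, pow_succ']
      exact Ideal.mul_mem_mul ha (hx ▸ Ideal.mem_span_singleton_self x)

lemma aux_principal {R : Type*} [CommRing R] [IsNoetherianRing R] [IsLocalRing R] (v : ℕ)
    (hv : 1 ≤ v) (h : ∃ x, maximalIdeal R ^ v = Ideal.span {x}) (i : ℕ) (hi : v ≤ i) :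
    ∃ x, maximalIdeal R ^ i = Ideal.span {x} := by
  induction i, hi using Nat.le_induction with
  | base => exact h
  | succ n hn ih =>
    obtain ⟨k, rfl⟩ : ∃ k, n = k + 1 := ⟨n - 1, by omega⟩
    exact aux_step k ih

lemma aux_len {S : Type*} [CommRing S] (A B : Ideal S) (hAB : A ≤ B) :
    Module.length S (S ⧸ A) = Module.length S (↥B ⧸ Submodule.comap B.subtype A) +
      Module.length S (S ⧸ B) := by
  refine Module.length_eq_add_of_exact (Submodule.mapQ _ A B.subtype le_rfl)
    (Submodule.factor hAB) ?_ (Submodule.factor_surjective hAB) ?_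
  · rw [← LinearMap.ker_eq_bot, Submodule.ker_mapQ, Submodule.mkQ_map_self]
  · rw [LinearMap.exact_iff, Submodule.range_mapQ]
    simp [Submodule.factor, Submodule.ker_mapQ]

lemma aux_sum {S : Type*} [CommRing S] (J : ℕ → Ideal S) (h0 : J 0 = ⊤)
    (hJ : ∀ i, J (i+1) ≤ J i) (h : ℕ → ℕ)
    (hh : ∀ i, Module.length S (↥(J i) ⧸ Submodule.comap (J i).subtype (J (i+1))) = h i) (n : ℕ) :
    Module.length S (S ⧸ J n) = ((∑ i ∈ Finset.range n, h i : ℕ) : ℕ∞) := by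
  induction n with
  | zero =>
    have : Subsingleton (S ⧸ J 0) := Ideal.Quotient.subsingleton_iff.2 h0
    simp
  | succ n ih =>
    rw [aux_len _ _ (hJ n), hh, ih, Finset.sum_range_succ]
    push_cast; rw [add_comm]

/-- Let `(S, 𝔫)` be a Noetherian local ring and `I` an `𝔫`-primary ideal
which is not a power of `𝔫`; let `R = S ⧸ I` with maximal ideal `𝔪 = 𝔫/I`,
`v = v_S(I)`, `ℓ = ℓ_S(R)`, `hS`/`hR` the Hilbert functions of `S`/`R`, and `s` the top
socle degree of `R`.  Then the following are equivalent:
(1) `s = ℓ − Σ_{i=0}^{v−1} hS i + v − 1`;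
(2) `μ_R(𝔪^v) = 1` (i.e. `𝔪^v` is a nonzero principal ideal);
(3) `hR i = 1` for all `v ≤ i ≤ s` and `hR i = 0` for all `i > s`. -/
theorem top_socle_degree_eq_iff
    (S : Type*) [CommRing S] [IsNoetherianRing S] [IsLocalRing S]
    (I : Ideal S) (hprim : I.radical = maximalIdeal S)
    (hnotpow : ∀ n : ℕ, I ≠ maximalIdeal S ^ n)
    (ℓ : ℕ) (hℓ : moduleLength S (S ⧸ I) = (ℓ : ℕ∞))
    (hS : ℕ → ℕ)
    (hhS : ∀ i : ℕ, moduleLength S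
        (↥(maximalIdeal S ^ i) ⧸
          Submodule.comap (maximalIdeal S ^ i).subtype (maximalIdeal S ^ (i + 1))) =
        ((hS i : ℕ∞) : WithBot ℕ∞))
    (hR : ℕ → ℕ)
    (hhR : ∀ i : ℕ, moduleLength S
        (↥(maximalIdeal S ^ i ⊔ I) ⧸
          Submodule.comap (maximalIdeal S ^ i ⊔ I).subtype (maximalIdeal S ^ (i + 1) ⊔ I)) =
        ((hR i : ℕ∞) : WithBot ℕ∞))
    (v : ℕ) (hv : IsGreatest {n : ℕ | I ≤ maximalIdeal S ^ n} v)
    (s : ℕ)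
    (hs : IsGreatest {n : ℕ |
        ((maximalIdeal S).map (Ideal.Quotient.mk I)) ^ n ≠ ⊥} s) :
    (((s : ℤ) = (ℓ : ℤ) - (∑ i ∈ Finset.range v, (hS i : ℤ)) + v - 1) ↔
      ((∃ x : S ⧸ I, ((maximalIdeal S).map (Ideal.Quotient.mk I)) ^ v = Ideal.span {x}) ∧
        ((maximalIdeal S).map (Ideal.Quotient.mk I)) ^ v ≠ ⊥)) ∧
    (((s : ℤ) = (ℓ : ℤ) - (∑ i ∈ Finset.range v, (hS i : ℤ)) + v - 1) ↔
      ((∀ i : ℕ, v ≤ i → i ≤ s → hR i = 1) ∧ (∀ i : ℕ, s < i → hR i = 0))) := by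
  have hne : I ≠ ⊤ := by simpa using hnotpow 0
  have : Nontrivial (S ⧸ I) := Ideal.Quotient.nontrivial_iff.2 hne
  have hsurj := Ideal.Quotient.mk_surjective (I := I)
  have : IsLocalRing (S ⧸ I) := IsLocalRing.of_surjective' (Ideal.Quotient.mk I) hsurj
  have hmm := IsLocalRing.map_maximalIdeal_of_surjective _ hsurj
  set J : ℕ → Ideal S := fun i => maximalIdeal S ^ i ⊔ I with hJdef
  have hcomap : ∀ i, Ideal.comap (Ideal.Quotient.mk I) (maximalIdeal (S ⧸ I) ^ i) = J i := by
    intro i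
    rw [← hmm, ← Ideal.map_pow, Ideal.comap_map_of_surjective _ hsurj]
    simp [hJdef, ← RingHom.ker_eq_comap_bot]
  rw [hmm] at hs ⊢
  have hJanti : ∀ i, J (i+1) ≤ J i := fun i =>
    sup_le_sup_right (Ideal.pow_le_pow_right (Nat.le_succ i)) _
  have hlR : ∀ i, Module.length S (↥(J i) ⧸ Submodule.comap (J i).subtype (J (i+1))) = hR i := by
    intro i
    apply WithBot.coe_injective
    rw [Module.coe_length]; exact hhR i
  have hlS : ∀ i, Module.length S (↥(maximalIdeal S ^ i) ⧸
      Submodule.comap (maximalIdeal S ^ i).subtype (maximalIdeal S ^ (i+1))) = hS i := by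
    intro i
    apply WithBot.coe_injective
    rw [Module.coe_length]; exact hhS i
  have hl : Module.length S (S ⧸ I) = ℓ := by
    apply WithBot.coe_injective
    rw [Module.coe_length]; exact hℓ
  -- the Hilbert function is one exactly for covering relations
  have hone : ∀ i, hR i = 1 ↔ ((∃ x, maximalIdeal (S ⧸ I) ^ i = Ideal.span {x}) ∧
      maximalIdeal (S ⧸ I) ^ i ≠ ⊥) := by
    intro i
    have hc : (Set.range (Ideal.orderEmbeddingOfSurjective _ hsurj)).OrdConnected := by
      refine Set.ordConnected_iff.2 ?_
      rintro _ ⟨a, rfl⟩ _ _ _ K ⟨hK, _⟩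
      refine ⟨K.map (Ideal.Quotient.mk I), ?_⟩
      change Ideal.comap _ (Ideal.map _ _) = K
      rw [Ideal.comap_map_of_surjective _ hsurj, sup_eq_left]
      exact (Ideal.comap_mono bot_le).trans hK
    rw [aux_cov, ← hc.apply_covBy_apply_iff]
    change _ ↔ Ideal.comap _ _ ⋖ Ideal.comap _ _
    rw [hcomap, hcomap, covBy_iff_quot_is_simple (hJanti i), ← Module.length_eq_one_iff, hlR]
    norm_cast
  have hbot : ∀ i, maximalIdeal (S ⧸ I) ^ i = ⊥ ↔ s < i := by
    intro i
    constructor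
    · intro h
      by_contra h'
      exact hs.1 (le_bot_iff.1 (h ▸ Ideal.pow_le_pow_right (not_lt.1 h')))
    · intro h
      by_contra h'
      exact absurd (hs.2 h') (not_le.2 h)
  have hpos : ∀ i, hR i = 0 ↔ s < i := by
    intro i
    rw [← hbot]
    have h1 : hR i = 0 ↔ J i ≤ J (i+1) := by
      rw [← Nat.cast_inj (R := ℕ∞), ← hlR, Nat.cast_zero, Module.length_eq_zero_iff,
        Submodule.Quotient.subsingleton_iff, Submodule.comap_subtype_eq_top]
    rw [h1, ← hcomap, ← hcomap, Ideal.comap_le_comap_iff_of_surjective _ hsurj]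
    refine ⟨aux_nak i, fun h => by simp [h]⟩
  have hIv := hv.1
  have hv1 : 1 ≤ v := by
    apply hv.2
    change I ≤ maximalIdeal S ^ 1
    rw [pow_one]; exact IsLocalRing.le_maximalIdeal hne
  have hJle : ∀ i ≤ v, J i = maximalIdeal S ^ i := fun i hi =>
    sup_eq_left.2 (le_trans hIv (Ideal.pow_le_pow_right hi))
  have hvs : v ≤ s := by
    by_contra h
    have h2 := (hbot v).2 (not_le.1 h)
    have h3 := hcomap v
    rw [h2, hJle v le_rfl, ← RingHom.ker_eq_comap_bot, Ideal.mk_ker] at h3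
    exact hnotpow v h3
  have hRS : ∀ i < v, hR i = hS i := by
    intro i hi
    rw [← Nat.cast_inj (R := ℕ∞), ← hlR, ← hlS, hJle i hi.le, hJle (i+1) hi]
  have hJs : J (s+1) = I := by
    rw [← hcomap, (hbot _).2 (Nat.lt_succ_self s), ← RingHom.ker_eq_comap_bot, Ideal.mk_ker]
  have hsum : ℓ = ∑ i ∈ Finset.range (s+1), hR i := by
    have := aux_sum J (by simp [hJdef]) hJanti hR hlR (s+1)
    rw [hJs, hl] at this
    exact_mod_cast this
  have hsum2 : (ℓ : ℤ) - ∑ i ∈ Finset.range v, (hS i : ℤ) = ∑ i ∈ Finset.Ico v (s+1), (hR i : ℤ) := by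
    rw [hsum, ← Finset.sum_congr rfl (fun i hi => congrArg Nat.cast (hRS i (Finset.mem_range.1 hi))),
      Finset.sum_Ico_eq_sub _ (by omega : v ≤ s+1)]
    push_cast; rfl
  have h13 : ((s : ℤ) = (ℓ : ℤ) - (∑ i ∈ Finset.range v, (hS i : ℤ)) + v - 1) ↔
      (∀ i : ℕ, v ≤ i → i ≤ s → hR i = 1) := by
    have hge : ∀ i ∈ Finset.Ico v (s+1), (1:ℤ) ≤ hR i := by
      intro i hi
      have := (hpos i).not.2 (by simp at hi; omega)
      omega
    have key := Finset.sum_eq_sum_iff_of_le hge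
    have hc : ∑ i ∈ Finset.Ico v (s+1), (1:ℤ) = s + 1 - v := by
      simp; omega
    rw [hc] at key
    rw [hsum2]
    have : ((s:ℤ) = ∑ i ∈ Finset.Ico v (s+1), (hR i : ℤ) + v - 1) ↔
      (s + 1 - v : ℤ) = ∑ i ∈ Finset.Ico v (s+1), (hR i : ℤ) := by constructor <;> intro h <;> linarith
    rw [this, key]
    constructor
    · intro h i h1 h2
      have := h i (by simp; omega)
      omega
    · intro h i hi
      simp at hi
      rw [h i (by omega) (by omega)]; rfl
  refine ⟨h13.trans ⟨fun h => (hone v).1 (h v le_rfl hvs), fun h i h1 h2 => (hone i).2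
    ⟨aux_principal v hv1 h.1 i h1, fun h0 => absurd ((hbot i).1 h0) (not_lt.2 h2)⟩⟩,
    h13.trans ⟨fun h => ⟨h, fun i hi => (hpos i).2 hi⟩, fun h => h.1⟩⟩
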